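/- Suppose a voting configuration (v_ch, v_pr, l_ch, l_pr) on 5 parties satisfies the constraints, and suppose l_ch^q = 1 and l_ch^{q'} = 1 for parties q ≠ q'. Then ∑_{k≠q} v_ch^{k→q} + ∑_{k≠q'} v_ch^{k→q'} ≤ 5, and consequently one cannot have both sums ≥ 3; hence the assumption is contradictory (two distinct chancellors are impossible). -/

import Mathlib

open Finset

/-- A voting configuration on 5 parties: binary chancellor/president votes
`vch q k`, `vpr q k` (vote of party `q` for party `k`; the diagonal is
normalized to `0` since only pairs with `k ≠ q` carry a vote), and binary
labels `lch q` (is `q` chancellor?) and `lpr q` (is `q` president?). -/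
structure Config where
  vch : Fin 5 → Fin 5 → ℕ
  vpr : Fin 5 → Fin 5 → ℕ
  lch : Fin 5 → ℕ
  lpr : Fin 5 → ℕ
  vch_le : ∀ q k, vch q k ≤ 1
  vpr_le : ∀ q k, vpr q k ≤ 1
  lch_le : ∀ q, lch q ≤ 1
  lpr_le : ∀ q, lpr q ≤ 1
  vch_diag : ∀ q, vch q q = 0
  vpr_diag : ∀ q, vpr q q = 0

/-- The constraints (i)–(iv) on a voting configuration. -/
def Config.Satisfies (c : Config) : Prop :=
  (∀ q, ∑ k ∈ univ.filter (· ≠ q), c.vch q k ≤ 1) ∧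
  (∀ q, ∑ k ∈ univ.filter (· ≠ q), c.vpr q k ≤ c.lch q) ∧
  (∀ q, (c.lch q = 1 ↔ 3 ≤ ∑ k ∈ univ.filter (· ≠ q), c.vch k q)) ∧
  (∀ q, c.lpr q = ∑ k ∈ univ.filter (· ≠ q),
      c.vpr k q *
        (if 3 ≤ ∑ q' ∈ univ.filter (fun x => x ≠ k ∧ x ≠ q), c.vch q' k then 1 else 0))

/-- The diagonal of `vch` vanishes, so restricting an incoming vote sum to the other parties
does not change it. -/
theorem Config.sum_vch_ne (c : Config) (q : Fin 5) :
    ∑ k ∈ univ.filter (· ≠ q), c.vch k q = ∑ k, c.vch k q := by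
  refine Finset.sum_filter_of_ne fun k _ hk hkq => hk ?_
  rw [hkq, c.vch_diag]

/-- Each party casts at most one chancellor vote, so two distinct parties together receive at
most one chancellor vote from each party. -/
theorem Config.Satisfies.vch_add_vch_le_one {c : Config} (hc : c.Satisfies) {q q' : Fin 5}
    (hqq : q ≠ q') (k : Fin 5) : c.vch k q + c.vch k q' ≤ 1 := by
  by_cases hq : q = k
  · rw [hq, c.vch_diag, zero_add]
    exact c.vch_le k q'
  by_cases hq' : q' = k
  · rw [hq', c.vch_diag, add_zero]
    exact c.vch_le k q
  calc c.vch k q + c.vch k q' = ∑ j ∈ {q, q'}, c.vch k j := (Finset.sum_pair hqq).symm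
    _ ≤ ∑ j ∈ univ.filter (· ≠ k), c.vch k j :=
        Finset.sum_le_sum_of_subset (by simp [Finset.insert_subset_iff, hq, hq'])
    _ ≤ 1 := hc.1 k

/-- Two distinct parties together receive at most five chancellor votes. -/
theorem Config.Satisfies.sum_vch_add_sum_vch_le {c : Config} (hc : c.Satisfies) {q q' : Fin 5}
    (hqq : q ≠ q') :
    (∑ k ∈ univ.filter (· ≠ q), c.vch k q) +
      (∑ k ∈ univ.filter (· ≠ q'), c.vch k q') ≤ 5 := by
  rw [c.sum_vch_ne, c.sum_vch_ne, ← Finset.sum_add_distrib]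
  simpa using Finset.sum_le_card_nsmul univ _ 1 fun k _ => hc.vch_add_vch_le_one hqq k

/-- Two distinct chancellors are impossible: the two incoming chancellor-vote
sums total at most 5, so they cannot both be at least 3, contradicting the
assumption. -/
theorem two_chancellors_impossible (c : Config) (hc : c.Satisfies)
    (q q' : Fin 5) (hqq : q ≠ q') (hq : c.lch q = 1) (hq' : c.lch q' = 1) :
    ((∑ k ∈ univ.filter (· ≠ q), c.vch k q) +
      (∑ k ∈ univ.filter (· ≠ q'), c.vch k q') ≤ 5) ∧
    ¬(3 ≤ ∑ k ∈ univ.filter (· ≠ q), c.vch k q ∧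
      3 ≤ ∑ k ∈ univ.filter (· ≠ q'), c.vch k q') ∧
    False := by
  have hle := hc.sum_vch_add_sum_vch_le hqq
  have h := (hc.2.2.1 q).mp hq
  have h' := (hc.2.2.1 q').mp hq'
  exact ⟨hle, by omega, by omega⟩
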